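/- arXiv:2302.04715 — 2 statements merged into one kernel-verified Lean document; each statement's English description precedes it below -/
import Mathlib

section
/- In the shrinkage prior setup with a ≥ 1/2 and L satisfying Assumption 1, let 0 ≤ b < 1/2 and K₀ > 0 be constants. For each n ≥ 2 let Z_{n,1}, …, Z_{n,m} be i.i.d. standard normal random variables and θ_n ∈ ℝ^m with ‖θ_n‖² ≥ K₀ n^{1−2b}, and set W_n = Σ_{j=1}^m (Z_{n,j} + θ_{n,j})². If (τ_n) are positive reals with τ_n → 0 and log(1/τ_n) = O(log n), then R(τ_n, W_n) → 1 in probability as n → ∞. (Proposition 2: for an active group, the posterior shrinkage weight tends to 1 in probability.) -/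
open Filter MeasureTheory ProbabilityTheory

/-- Unnormalized posterior density of the shrinkage coefficient `κ ∈ (0,1)`:
`π(κ; τ, w) = κ^(a+m/2-1) (1-κ)^(-a-1) L(τ⁻²(κ⁻¹-1)) exp(-κw/2)`. -/
noncomputable def postDensity (a : ℝ) (m : ℕ) (L : ℝ → ℝ) (τ w κ : ℝ) : ℝ :=
  κ ^ (a + (m : ℝ) / 2 - 1) * (1 - κ) ^ (-a - 1) * L ((κ⁻¹ - 1) / τ ^ 2) *
    Real.exp (-(κ * w) / 2)

/-- Posterior shrinkage weight `R(τ, w) = E(1 - κ | τ, w)`. -/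
noncomputable def shrinkWeight (a : ℝ) (m : ℕ) (L : ℝ → ℝ) (τ w : ℝ) : ℝ :=
  (∫ κ in (0 : ℝ)..1, (1 - κ) * postDensity a m L τ w κ) /
    ∫ κ in (0 : ℝ)..1, postDensity a m L τ w κ

lemma aux_q (a : ℝ) (L : ℝ → ℝ) (K : ℝ)
    (hLint : IntegrableOn (fun t : ℝ => t ^ (-a - 1) * L t) (Set.Ioi 0))
    (hKval : ∫ t in Set.Ioi (0 : ℝ), t ^ (-a - 1) * L t = 1 / K) (T : ℝ) (hT : 0 < T) :
    IntegrableOn (fun κ : ℝ => κ ^ (a - 1) * (1 - κ) ^ (-a - 1) * L ((κ⁻¹ - 1) / T))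
      (Set.Ioo 0 1) ∧
    ∫ κ in Set.Ioo (0 : ℝ) 1, κ ^ (a - 1) * (1 - κ) ^ (-a - 1) * L ((κ⁻¹ - 1) / T)
      = T ^ (-a) / K := by
  have himg : (fun κ : ℝ => (κ⁻¹ - 1) / T) '' Set.Ioo 0 1 = Set.Ioi 0 := by
    ext t
    simp only [Set.mem_image, Set.mem_Ioo, Set.mem_Ioi]
    constructor
    · rintro ⟨κ, ⟨h0, h1⟩, rfl⟩
      have := (one_lt_inv₀ h0).2 h1
      apply div_pos _ hT
      linarith
    · intro ht
      have h1 : 0 < T * t := mul_pos hT ht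
      refine ⟨(1 + T * t)⁻¹, ⟨by positivity, inv_lt_one_of_one_lt₀ (by linarith)⟩, ?_⟩
      rw [inv_inv]; field_simp; ring
  have hder : ∀ κ ∈ Set.Ioo (0 : ℝ) 1,
      HasDerivWithinAt (fun κ : ℝ => (κ⁻¹ - 1) / T) ((-(κ ^ 2)⁻¹) / T) (Set.Ioo 0 1) κ := by
    intro κ hκ
    exact (((hasDerivAt_inv hκ.1.ne').sub_const 1).div_const T).hasDerivWithinAt
  have hinj : Set.InjOn (fun κ : ℝ => (κ⁻¹ - 1) / T) (Set.Ioo 0 1) := by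
    intro x hx y hy hxy
    simp only at hxy
    rw [div_left_inj' hT.ne'] at hxy
    exact inv_injective (by linarith)
  have key : Set.EqOn (fun κ : ℝ => |(-(κ ^ 2)⁻¹) / T| •
        (((κ⁻¹ - 1) / T) ^ (-a - 1) * L ((κ⁻¹ - 1) / T)))
      (fun κ : ℝ => T ^ a * (κ ^ (a - 1) * (1 - κ) ^ (-a - 1) * L ((κ⁻¹ - 1) / T)))
      (Set.Ioo 0 1) := by
    intro κ hκ
    obtain ⟨h0, h1⟩ := hκ
    have h2 : 0 < 1 - κ := by linarith
    have e1 : |(-(κ ^ 2)⁻¹) / T| = κ ^ (-2 : ℝ) * T ^ (-1 : ℝ) := by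
      rw [neg_div, abs_neg, abs_of_pos (by positivity), Real.rpow_neg h0.le, Real.rpow_neg hT.le]
      norm_num [div_eq_mul_inv]
    have e2 : (κ⁻¹ - 1) / T = (1 - κ) * (κ ^ (-1 : ℝ) * T ^ (-1 : ℝ)) := by
      rw [Real.rpow_neg_one, Real.rpow_neg_one]; field_simp
    have e3 : ((κ⁻¹ - 1) / T) ^ (-a - 1) = (1 - κ) ^ (-a - 1) * (κ ^ (a + 1) * T ^ (a + 1)) := by
      rw [e2, Real.mul_rpow h2.le (by positivity), Real.mul_rpow (by positivity) (by positivity),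
        ← Real.rpow_mul h0.le, ← Real.rpow_mul hT.le]
      congr 3 <;> ring
    have e4 : κ ^ (a - 1) = κ ^ (-2 : ℝ) * κ ^ (a + 1) := by
      rw [← Real.rpow_add h0]; congr 1; ring
    have e5 : T ^ a = T ^ (-1 : ℝ) * T ^ (a + 1) := by
      rw [← Real.rpow_add hT]; congr 1; ring
    simp only [smul_eq_mul]
    rw [e1, e3, e4, e5]; ring
  have hI := (integrableOn_image_iff_integrableOn_abs_deriv_smul measurableSet_Ioo hder hinj
    (fun t : ℝ => t ^ (-a - 1) * L t))
  have hV := (integral_image_eq_integral_abs_deriv_smul measurableSet_Ioo hder hinj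
    (fun t : ℝ => t ^ (-a - 1) * L t))
  rw [himg] at hI hV
  have hTa : 0 < T ^ a := by positivity
  constructor
  · have h := (integrableOn_congr_fun key measurableSet_Ioo).1 (hI.1 hLint)
    have h' := h.const_mul (T ^ a)⁻¹
    refine h'.congr (Filter.Eventually.of_forall fun κ => ?_)
    simp only
    rw [← mul_assoc, inv_mul_cancel₀ hTa.ne', one_mul]
  · rw [hKval, setIntegral_congr_fun measurableSet_Ioo key, integral_const_mul] at hV
    rw [Real.rpow_neg hT.le, div_eq_mul_one_div, hV, ← mul_assoc, inv_mul_cancel₀ hTa.ne', one_mul]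

lemma aux_det (a : ℝ) (ha : 1 / 2 ≤ a) (m : ℕ) (hm : 1 ≤ m)
    (L : ℝ → ℝ) (hLmeas : Measurable L) (hLpos : ∀ x > 0, 0 < L x)
    (c₀ t₀ : ℝ) (hc₀ : 0 < c₀) (hLlow : ∀ t ≥ t₀, c₀ ≤ L t)
    (K : ℝ) (hK : 0 < K)
    (hLint : IntegrableOn (fun t : ℝ => t ^ (-a - 1) * L t) (Set.Ioi 0))
    (hKval : ∫ t in Set.Ioi (0 : ℝ), t ^ (-a - 1) * L t = 1 / K)
    (δ : ℝ) (hδ : 0 < δ) (hδ1 : δ < 1) :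
    ∃ C > 0, ∀ τ > 0, τ ^ 2 * t₀ ≤ 1 → ∀ w ≥ 0,
      |shrinkWeight a m L τ w - 1| ≤ δ + C * ((τ ^ 2) ^ (-a) * Real.exp (-(δ * w) / 4)) := by
  have hmR : (1 : ℝ) ≤ m := by exact_mod_cast hm
  set s : ℝ := a + (m : ℝ) / 2 - 1 with hs
  have hs0 : 0 ≤ s := by linarith
  set c₁ : ℝ := (δ / 4) ^ s * c₀ * (δ / 4) with hc₁
  have hc₁pos : 0 < c₁ := by positivity
  refine ⟨1 / K / c₁, by positivity, ?_⟩
  intro τ hτ hτt w hw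
  have hT : 0 < τ ^ 2 := by positivity
  obtain ⟨hqi, hqv⟩ := aux_q a L K hLint hKval (τ ^ 2) hT
  set q : ℝ → ℝ := fun κ : ℝ => κ ^ (a - 1) * (1 - κ) ^ (-a - 1) * L ((κ⁻¹ - 1) / τ ^ 2) with hq
  have hLp : ∀ κ ∈ Set.Ioo (0 : ℝ) 1, 0 < L ((κ⁻¹ - 1) / τ ^ 2) := by
    intro κ hκ
    apply hLpos
    have := (one_lt_inv₀ hκ.1).2 hκ.2
    exact div_pos (by linarith) hT
  have hqpos : ∀ κ ∈ Set.Ioo (0 : ℝ) 1, 0 < q κ := by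
    intro κ hκ
    have h1 : 0 < 1 - κ := by linarith [hκ.2]
    have h0 := hκ.1
    have := hLp κ hκ
    simp only [hq]; positivity
  have hp : ∀ κ ∈ Set.Ioo (0 : ℝ) 1,
      postDensity a m L τ w κ = κ ^ ((m : ℝ) / 2) * Real.exp (-(κ * w) / 2) * q κ := by
    intro κ hκ
    have : κ ^ (a + (m : ℝ) / 2 - 1) = κ ^ (a - 1) * κ ^ ((m : ℝ) / 2) := by
      rw [← Real.rpow_add hκ.1]; congr 1; ring
    simp only [postDensity, hq]
    rw [this]; ring
  have hppos : ∀ κ ∈ Set.Ioo (0 : ℝ) 1, 0 < postDensity a m L τ w κ := by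
    intro κ hκ
    rw [hp κ hκ]
    have h0 := hκ.1
    have := hqpos κ hκ
    positivity
  have hpe : ∀ κ ∈ Set.Ioo (0 : ℝ) 1,
      postDensity a m L τ w κ ≤ Real.exp (-(κ * w) / 2) * q κ := by
    intro κ hκ
    rw [hp κ hκ]
    have h0 := hκ.1
    have h3 := hqpos κ hκ
    have h4 : κ ^ ((m : ℝ) / 2) ≤ 1 := Real.rpow_le_one h0.le hκ.2.le (by positivity)
    have h5 : 0 < Real.exp (-(κ * w) / 2) := Real.exp_pos _
    gcongr
    exact mul_le_of_le_one_left h5.le h4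
  have hpq : ∀ κ ∈ Set.Ioo (0 : ℝ) 1, postDensity a m L τ w κ ≤ q κ := by
    intro κ hκ
    refine (hpe κ hκ).trans ?_
    refine mul_le_of_le_one_left (hqpos κ hκ).le (Real.exp_le_one_iff.2 ?_)
    have := mul_nonneg hκ.1.le hw
    linarith
  have hmeas : Measurable (postDensity a m L τ w) := by
    unfold postDensity
    fun_prop
  have hpi : IntegrableOn (postDensity a m L τ w) (Set.Ioo 0 1) := by
    refine Integrable.mono' hqi hmeas.aestronglyMeasurable ?_
    refine (ae_restrict_iff' measurableSet_Ioo).2 (Filter.Eventually.of_forall fun κ hκ => ?_)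
    rw [Real.norm_of_nonneg (hppos κ hκ).le]
    exact hpq κ hκ
  have hkpi : IntegrableOn (fun κ => κ * postDensity a m L τ w κ) (Set.Ioo 0 1) := by
    refine Integrable.mono' hpi (measurable_id.mul hmeas).aestronglyMeasurable ?_
    refine (ae_restrict_iff' measurableSet_Ioo).2 (Filter.Eventually.of_forall fun κ hκ => ?_)
    have h := hppos κ hκ
    rw [Real.norm_of_nonneg (mul_nonneg hκ.1.le h.le)]
    exact mul_le_of_le_one_left h.le hκ.2.le
  -- denominator
  set D : ℝ := ∫ κ in Set.Ioo (0 : ℝ) 1, postDensity a m L τ w κ with hD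
  set N : ℝ := ∫ κ in Set.Ioo (0 : ℝ) 1, κ * postDensity a m L τ w κ with hN
  have hDlow : c₁ * Real.exp (-(δ * w) / 4) ≤ D := by
    have hsub : Set.Ioo (δ / 4) (δ / 2) ⊆ Set.Ioo (0 : ℝ) 1 :=
      Set.Ioo_subset_Ioo (by linarith) (by linarith)
    have h1 : ∫ κ in Set.Ioo (δ / 4) (δ / 2), postDensity a m L τ w κ ≤ D := by
      refine setIntegral_mono_set hpi ?_ hsub.eventuallyLE
      exact (ae_restrict_iff' measurableSet_Ioo).2
        (Filter.Eventually.of_forall fun κ hκ => (hppos κ hκ).le)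
    refine le_trans ?_ h1
    have h2 : ∫ κ in Set.Ioo (δ / 4) (δ / 2), ((δ / 4) ^ s * c₀ * Real.exp (-(δ * w) / 4))
        = c₁ * Real.exp (-(δ * w) / 4) := by
      rw [setIntegral_const, measureReal_def, Real.volume_Ioo,
        ENNReal.toReal_ofReal (by linarith), smul_eq_mul, hc₁]
      ring
    rw [← h2]
    refine setIntegral_mono_on (integrableOn_const (by simp)) (hpi.mono_set hsub)
      measurableSet_Ioo ?_
    intro κ hκ
    obtain ⟨hk0, hk1⟩ := hκ
    have hκ0 : 0 < κ := by linarith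
    have h1κ : 0 < 1 - κ := by linarith
    have a1 : (δ / 4) ^ s ≤ κ ^ s := Real.rpow_le_rpow (by linarith) hk0.le hs0
    have a2 : 1 ≤ (1 - κ) ^ (-a - 1) :=
      Real.one_le_rpow_of_pos_of_le_one_of_nonpos h1κ (by linarith) (by linarith)
    have a3 : c₀ ≤ L ((κ⁻¹ - 1) / τ ^ 2) := by
      apply hLlow
      rw [ge_iff_le, le_div_iff₀ hT]
      have : 2 ≤ κ⁻¹ := by
        rw [le_inv_comm₀ (by norm_num) hκ0]; norm_num; linarith
      nlinarith
    have a4 : Real.exp (-(δ * w) / 4) ≤ Real.exp (-(κ * w) / 2) := by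
      apply Real.exp_le_exp.2
      nlinarith
    unfold postDensity
    have b1 : (δ / 4) ^ s ≤ κ ^ s * (1 - κ) ^ (-a - 1) :=
      a1.trans (le_mul_of_one_le_right (by positivity) a2)
    have b0 : 0 ≤ κ ^ s * (1 - κ) ^ (-a - 1) * L ((κ⁻¹ - 1) / τ ^ 2) :=
      mul_nonneg (by positivity) (hc₀.le.trans a3)
    gcongr
  have hDpos : 0 < D := lt_of_lt_of_le (by positivity) hDlow
  have hNup : N ≤ δ * D + Real.exp (-(δ * w) / 2) * ((τ ^ 2) ^ (-a) / K) := by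
    rw [← hqv, hD, ← integral_const_mul, ← integral_const_mul,
      ← integral_add (hpi.const_mul δ) (hqi.const_mul _)]
    refine setIntegral_mono_on hkpi ((hpi.const_mul δ).add (hqi.const_mul _)) measurableSet_Ioo ?_
    intro κ hκ
    have h3 := hqpos κ hκ
    have h4 := hppos κ hκ
    have h6 := hpe κ hκ
    change κ * postDensity a m L τ w κ
      ≤ δ * postDensity a m L τ w κ + Real.exp (-(δ * w) / 2) * q κ
    rcases le_total κ δ with h | h
    · have := mul_le_mul_of_nonneg_right h h4.le
      have : 0 ≤ Real.exp (-(δ * w) / 2) * q κ := by positivity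
      linarith
    · have e : Real.exp (-(κ * w) / 2) ≤ Real.exp (-(δ * w) / 2) := by
        apply Real.exp_le_exp.2
        nlinarith
      have e2 := mul_le_mul_of_nonneg_right e h3.le
      have e3 : κ * postDensity a m L τ w κ ≤ postDensity a m L τ w κ :=
        mul_le_of_le_one_left h4.le hκ.2.le
      have : 0 ≤ δ * postDensity a m L τ w κ := by positivity
      linarith
  have hN0 : 0 ≤ N := setIntegral_nonneg measurableSet_Ioo
    fun κ hκ => mul_nonneg hκ.1.le (hppos κ hκ).le
  have hR : shrinkWeight a m L τ w = (D - N) / D := by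
    unfold shrinkWeight
    rw [intervalIntegral.integral_of_le zero_le_one, intervalIntegral.integral_of_le zero_le_one,
      integral_Ioc_eq_integral_Ioo, integral_Ioc_eq_integral_Ioo, ← hD, hN, hD,
      ← integral_sub hpi hkpi]
    congr 2
    funext κ
    ring
  have hR2 : |shrinkWeight a m L τ w - 1| = N / D := by
    rw [hR, sub_div, div_self hDpos.ne', sub_sub_cancel_left, abs_neg, abs_of_nonneg (by positivity)]
  rw [hR2, div_le_iff₀ hDpos, add_mul]
  refine hNup.trans (add_le_add le_rfl ?_)
  have hee : Real.exp (-(δ * w) / 2) = Real.exp (-(δ * w) / 4) * Real.exp (-(δ * w) / 4) := by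
    rw [← Real.exp_add]; congr 1; ring
  calc Real.exp (-(δ * w) / 2) * ((τ ^ 2) ^ (-a) / K)
      = 1 / K / c₁ * ((τ ^ 2) ^ (-a) * Real.exp (-(δ * w) / 4))
        * (c₁ * Real.exp (-(δ * w) / 4)) := by
        rw [hee]; field_simp
    _ ≤ _ := by gcongr

lemma aux_rate (a : ℝ) (ha : 0 < a) (p : ℝ) (hp : 0 < p) (c : ℝ) (hc : 0 < c)
    (τ : ℕ → ℝ) (hτpos : ∀ n, 0 < τ n)
    (hτlog : (fun n => Real.log (1 / τ n)) =O[atTop] fun n : ℕ => Real.log n) :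
    Tendsto (fun n : ℕ => (τ n ^ 2) ^ (-a) * Real.exp (-(c * (n : ℝ) ^ p))) atTop (nhds 0) := by
  have h1 : (fun n => Real.log (1 / τ n)) =o[atTop] fun n : ℕ => (n : ℝ) ^ p :=
    hτlog.trans_isLittleO ((isLittleO_log_rpow_atTop hp).comp_tendsto tendsto_natCast_atTop_atTop)
  have h2 := h1.bound (c := c / (4 * a)) (by positivity)
  have hinf : Tendsto (fun n : ℕ => (n : ℝ) ^ p) atTop atTop :=
    (tendsto_rpow_atTop hp).comp tendsto_natCast_atTop_atTop
  have h3 : Tendsto (fun n : ℕ => Real.exp (-(c / 2 * (n : ℝ) ^ p))) atTop (nhds 0) :=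
    Real.tendsto_exp_neg_atTop_nhds_zero.comp (hinf.const_mul_atTop (by positivity))
  refine squeeze_zero' (Filter.Eventually.of_forall fun n => by have := hτpos n; positivity) ?_ h3
  filter_upwards [h2] with n hn
  have ht := hτpos n
  rw [Real.norm_of_nonneg (by positivity : (0 : ℝ) ≤ (n : ℝ) ^ p)] at hn
  have hn' := (le_abs_self _).trans hn
  rw [Real.rpow_def_of_pos (by positivity), ← Real.exp_add, Real.log_pow]
  apply Real.exp_le_exp.2
  rw [one_div, Real.log_inv] at hn'
  have := mul_le_mul_of_nonneg_left hn' (by positivity : 0 ≤ 2 * a)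
  have e : 2 * a * (c / (4 * a) * (n : ℝ) ^ p) = c / 2 * (n : ℝ) ^ p := by field_simp; ring
  rw [e] at this
  push_cast
  linarith

lemma aux_tail (m : ℕ) (ν : Measure (Fin m → ℝ)) [IsProbabilityMeasure ν] :
    Tendsto (fun r : ℝ => ν {z | r < ∑ j, z j ^ 2}) atTop (nhds 0) := by
  have h := tendsto_measure_iInter_atTop (μ := ν) (s := fun r : ℝ => {z : Fin m → ℝ | r < ∑ j, z j ^ 2})
    (fun r => (measurableSet_lt (by fun_prop) (by fun_prop)).nullMeasurableSet)
    (fun r r' hrr z hz => lt_of_le_of_lt hrr hz) ⟨0, measure_ne_top _ _⟩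
  have he : (⋂ r : ℝ, {z : Fin m → ℝ | r < ∑ j, z j ^ 2}) = ∅ := by
    ext z
    simp only [Set.mem_iInter, Set.mem_ofPred_eq, Set.mem_empty_iff_false, iff_false, not_forall]
    exact ⟨_, lt_irrefl _⟩
  rwa [he, measure_empty] at h

/-- **Proposition 2.** In the shrinkage prior setup with `a ≥ 1/2` and `L` satisfying Assumption 1,
let `0 ≤ b < 1/2` and `K₀ > 0`. For each `n ≥ 2` let `Z_{n,1}, …, Z_{n,m}` be i.i.d. standard
normal, `θ_n ∈ ℝ^m` with `‖θ_n‖² ≥ K₀ n^(1-2b)`, and `W_n = Σ_j (Z_{n,j} + θ_{n,j})²`.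
If `τ_n → 0` with `log(1/τ_n) = O(log n)`, then `R(τ_n, W_n) → 1` in probability. -/
theorem prop2_active_group_not_shrunk
    {Ω : Type*} [MeasureSpace Ω] [IsProbabilityMeasure (ℙ : Measure Ω)]
    (a : ℝ) (ha : 1 / 2 ≤ a) (m : ℕ) (hm : 1 ≤ m)
    (L : ℝ → ℝ) (hLmeas : Measurable L) (hLpos : ∀ x > 0, 0 < L x)
    (hLsv : ∀ c > 0, Tendsto (fun x => L (c * x) / L x) atTop (nhds 1))
    (c₀ t₀ : ℝ) (hc₀ : 0 < c₀) (ht₀ : 0 < t₀) (hLlow : ∀ t ≥ t₀, c₀ ≤ L t)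
    (M : ℝ) (hLup : ∀ t > 0, L t ≤ M)
    (K : ℝ) (hK : 0 < K)
    (hLint : IntegrableOn (fun t : ℝ => t ^ (-a - 1) * L t) (Set.Ioi 0))
    (hKval : ∫ t in Set.Ioi (0 : ℝ), t ^ (-a - 1) * L t = 1 / K)
    (b : ℝ) (hb0 : 0 ≤ b) (hb : b < 1 / 2) (K₀ : ℝ) (hK₀ : 0 < K₀)
    (Z : ℕ → Fin m → Ω → ℝ) (hZmeas : ∀ n j, Measurable (Z n j))
    (hZlaw : ∀ n ≥ 2, Measure.map (fun ω (j : Fin m) => Z n j ω) ℙ =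
      Measure.pi fun _ : Fin m => gaussianReal 0 1)
    (θ : ℕ → Fin m → ℝ)
    (hθ : ∀ n : ℕ, 2 ≤ n → K₀ * (n : ℝ) ^ (1 - 2 * b) ≤ ∑ j, θ n j ^ 2)
    (τ : ℕ → ℝ) (hτpos : ∀ n, 0 < τ n) (hτ0 : Tendsto τ atTop (nhds 0))
    (hτlog : (fun n => Real.log (1 / τ n)) =O[atTop] fun n : ℕ => Real.log n) :
    ∀ ε > (0 : ℝ),
      Tendsto
        (fun n =>
          ℙ {ω | ε < |shrinkWeight a m L (τ n) (∑ j, (Z n j ω + θ n j) ^ 2) - 1|})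
        atTop (nhds 0) := by
  intro ε hε
  obtain ⟨δ, hδ, hδ1, hδε⟩ : ∃ δ : ℝ, 0 < δ ∧ δ < 1 ∧ δ ≤ ε / 2 :=
    ⟨min (1 / 2) (ε / 2), by positivity, lt_of_le_of_lt (min_le_left _ _) (by norm_num),
      min_le_right _ _⟩
  obtain ⟨C, hC, hdet⟩ := aux_det a ha m hm L hLmeas hLpos c₀ t₀ hc₀ hLlow K hK hLint hKval δ hδ hδ1
  have hp : 0 < 1 - 2 * b := by linarith
  have hrate := (aux_rate a (by linarith) (1 - 2 * b) hp (δ * K₀ / 16) (by positivity) τ hτpos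
    hτlog).const_mul C
  rw [mul_zero] at hrate
  have hsmall : ∀ᶠ n in atTop, τ n ^ 2 * t₀ ≤ 1 := by
    have h : Tendsto (fun n => τ n ^ 2 * t₀) atTop (nhds 0) := by
      simpa using (hτ0.pow 2).mul_const t₀
    exact (h.eventually_lt_const one_pos).mono fun n hn => hn.le
  have hinf : Tendsto (fun n : ℕ => K₀ / 4 * (n : ℝ) ^ (1 - 2 * b)) atTop atTop :=
    ((tendsto_rpow_atTop hp).comp tendsto_natCast_atTop_atTop).const_mul_atTop (by positivity)
  have htail := (aux_tail m (Measure.pi fun _ : Fin m => gaussianReal 0 1)).comp hinf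
  refine tendsto_of_tendsto_of_tendsto_of_le_of_le' tendsto_const_nhds htail
    (Filter.Eventually.of_forall fun n => zero_le) ?_
  filter_upwards [hsmall, hrate.eventually_lt_const (half_pos hε), eventually_ge_atTop 2]
    with n h1 h2 h3
  simp only [Function.comp]
  rw [← hZlaw n h3, Measure.map_apply (measurable_pi_lambda _ fun j => hZmeas n j)
    (measurableSet_lt (by fun_prop) (by fun_prop))]
  apply measure_mono
  intro ω hω
  simp only [Set.mem_preimage, Set.mem_ofPred_eq] at hω ⊢
  by_contra hcon
  rw [not_lt] at hcon
  have hW : K₀ / 4 * (n : ℝ) ^ (1 - 2 * b) ≤ ∑ j, (Z n j ω + θ n j) ^ 2 := by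
    have hj : ∑ j, θ n j ^ 2 ≤ ∑ j, (2 * (Z n j ω + θ n j) ^ 2 + 2 * Z n j ω ^ 2) :=
      Finset.sum_le_sum fun j _ => by nlinarith [sq_nonneg (2 * Z n j ω + θ n j)]
    rw [Finset.sum_add_distrib, ← Finset.mul_sum, ← Finset.mul_sum] at hj
    have := hθ n h3
    linarith
  have hd := hdet (τ n) (hτpos n) h1 (∑ j, (Z n j ω + θ n j) ^ 2)
    (Finset.sum_nonneg fun j _ => sq_nonneg _)
  have hτn := hτpos n
  have hmono : C * ((τ n ^ 2) ^ (-a) * Real.exp (-(δ * ∑ j, (Z n j ω + θ n j) ^ 2) / 4))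
      ≤ C * ((τ n ^ 2) ^ (-a) * Real.exp (-(δ * K₀ / 16 * (n : ℝ) ^ (1 - 2 * b)))) := by
    have : -(δ * ∑ j, (Z n j ω + θ n j) ^ 2) / 4 ≤ -(δ * K₀ / 16 * (n : ℝ) ^ (1 - 2 * b)) := by
      have := mul_le_mul_of_nonneg_left hW hδ.le
      linarith
    gcongr
  linarith
end

section
/- (Key step (5.42) in the proof of Theorem 2.) In the shrinkage prior setup with a ≥ 1/2, L satisfying Assumption 1, and group sizes bounded by a fixed integer s, define R₂_m(τ, w) = ∫₀¹ κ² π_m(κ; τ, w) dκ / ∫₀¹ π_m(κ; τ, w) dκ (the posterior mean of κ²). Suppose for each n ≥ 2: a finite active index set A_n with |A_n| ≤ G_n ≤ n; for each g ∈ A_n a group size m_{n,g} ∈ {1,…,s} and a random variable W_{n,g} = Σ_{j=1}^{m_{n,g}} (Z_{n,g,j} + θ_{n,g,j})² where the Z_{n,g,j} are i.i.d. standard normal and ‖θ_{n,g}‖² ≥ K₀ n for a constant K₀ > 0; and positive reals τ_n → 0 with G_n √τ_n log(1/τ_n) → ∞ and |A_n| · √τ_n log(1/τ_n) → 0. Then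 Σ_{g ∈ A_n} W_{n,g} · R₂_{m_{n,g}}(τ_n, W_{n,g}) → 0 in probability as n → ∞. -/
open Filter MeasureTheory ProbabilityTheory

/-- Posterior mean of `κ²`: `R₂_m(τ, w) = E(κ² | τ, w)`. -/
noncomputable def shrinkWeightSq (a : ℝ) (m : ℕ) (L : ℝ → ℝ) (τ w : ℝ) : ℝ :=
  (∫ κ in (0 : ℝ)..1, κ ^ 2 * postDensity a m L τ w κ) /
    ∫ κ in (0 : ℝ)..1, postDensity a m L τ w κ


noncomputable def hfun (a : ℝ) (L : ℝ → ℝ) (τ κ : ℝ) : ℝ :=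
  κ ^ (a - 1) * (1 - κ) ^ (-a - 1) * L ((κ⁻¹ - 1) / τ ^ 2)

lemma aux_image (τ : ℝ) (hτ : 0 < τ) :
    (fun t : ℝ => (1 + τ ^ 2 * t)⁻¹) '' Set.Ioi 0 = Set.Ioo 0 1 := by
  ext κ
  simp only [Set.mem_image, Set.mem_Ioi, Set.mem_Ioo]
  constructor
  · rintro ⟨t, ht, rfl⟩
    have : 0 < τ ^ 2 * t := by positivity
    exact ⟨by positivity, inv_lt_one_of_one_lt₀ (by linarith)⟩
  · rintro ⟨h0, h1⟩
    refine ⟨(κ⁻¹ - 1) / τ ^ 2, ?_, ?_⟩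
    · have := (one_lt_inv₀ h0).2 h1
      exact div_pos (by linarith) (by positivity)
    · field_simp
      ring

lemma aux_point (a : ℝ) (L : ℝ → ℝ) (τ t : ℝ) (hτ : 0 < τ) (ht : 0 < t) :
    |(-(τ ^ 2) / (1 + τ ^ 2 * t) ^ 2)| • hfun a L τ ((1 + τ ^ 2 * t)⁻¹)
      = (τ ^ 2) ^ (-a) * (t ^ (-a - 1) * L t) := by
  have hp : 0 < 1 + τ ^ 2 * t := by positivity
  obtain ⟨κ, hκ⟩ : ∃ κ, κ = (1 + τ ^ 2 * t)⁻¹ := ⟨_, rfl⟩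
  have hκ0 : 0 < κ := by rw [hκ]; positivity
  have e1 : |(-(τ ^ 2) / (1 + τ ^ 2 * t) ^ 2)| = τ ^ 2 * κ ^ 2 := by
    rw [abs_div, abs_neg, abs_of_pos (by positivity), abs_of_pos (by positivity), hκ]
    field_simp
  have e2 : 1 - κ = τ ^ 2 * t * κ := by
    rw [hκ]; field_simp; ring
  have e3 : (κ⁻¹ - 1) / τ ^ 2 = t := by
    rw [hκ, inv_inv]; field_simp; ring
  rw [← hκ, e1, hfun, e2, e3, Real.mul_rpow (by positivity) hκ0.le,
    Real.mul_rpow (by positivity) ht.le]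
  have e4 : κ ^ 2 * (κ ^ (a - 1) * κ ^ (-a - 1)) = 1 := by
    rw [← Real.rpow_natCast, ← Real.rpow_add hκ0, ← Real.rpow_add hκ0]
    have : ((2 : ℕ) : ℝ) + (a - 1 + (-a - 1)) = 0 := by push_cast; ring
    rw [this, Real.rpow_zero]
  have e5 : τ ^ 2 * (τ ^ 2) ^ (-a - 1) = (τ ^ 2) ^ (-a) := by
    rw [Real.rpow_sub_one (by positivity)]; field_simp
  rw [← e5, smul_eq_mul]
  calc _ = (κ ^ 2 * (κ ^ (a - 1) * κ ^ (-a - 1))) *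
        (τ ^ 2 * (τ ^ 2) ^ (-a - 1) * (t ^ (-a - 1) * L t)) := by ring
    _ = _ := by rw [e4, one_mul]

lemma aux_deriv (τ : ℝ) (x : ℝ) (hx : 0 < x) :
    HasDerivWithinAt (fun t : ℝ => (1 + τ ^ 2 * t)⁻¹)
      (-(τ ^ 2) / (1 + τ ^ 2 * x) ^ 2) (Set.Ioi 0) x := by
  have h1 : HasDerivAt (fun t : ℝ => 1 + τ ^ 2 * t) (τ ^ 2) x := by
    simpa using ((hasDerivAt_id x).const_mul (τ ^ 2)).const_add 1
  exact (h1.fun_inv (by positivity)).hasDerivWithinAt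

lemma aux_inj (τ : ℝ) (hτ : 0 < τ) :
    Set.InjOn (fun t : ℝ => (1 + τ ^ 2 * t)⁻¹) (Set.Ioi 0) := by
  intro x _ y _ h
  have h2 := inv_injective h
  have : τ ^ 2 ≠ 0 := by positivity
  exact mul_left_cancel₀ this (by linarith)

lemma hfun_int (a : ℝ) (L : ℝ → ℝ) (τ : ℝ) (hτ : 0 < τ)
    (hLint : IntegrableOn (fun t : ℝ => t ^ (-a - 1) * L t) (Set.Ioi 0)) :
    IntegrableOn (hfun a L τ) (Set.Ioo 0 1) ∧
    ∫ κ in Set.Ioo 0 1, hfun a L τ κ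
      = (τ ^ 2) ^ (-a) * ∫ t in Set.Ioi (0 : ℝ), t ^ (-a - 1) * L t := by
  rw [← aux_image τ hτ]
  constructor
  · rw [integrableOn_image_iff_integrableOn_abs_deriv_smul measurableSet_Ioi
      (fun x hx => aux_deriv τ x hx) (aux_inj τ hτ)]
    have hc : IntegrableOn (fun t : ℝ => (τ ^ 2) ^ (-a) * (t ^ (-a - 1) * L t)) (Set.Ioi 0) :=
      hLint.const_mul ((τ ^ 2) ^ (-a))
    refine hc.congr_fun ?_ measurableSet_Ioi
    intro t ht
    exact (aux_point a L τ t hτ ht).symm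
  · rw [integral_image_eq_integral_abs_deriv_smul measurableSet_Ioi
      (fun x hx => aux_deriv τ x hx) (aux_inj τ hτ), ← integral_const_mul]
    refine setIntegral_congr_fun measurableSet_Ioi ?_
    intro t ht
    exact aux_point a L τ t hτ ht

lemma post_eq (a : ℝ) (m : ℕ) (L : ℝ → ℝ) (τ w κ : ℝ) (h0 : 0 < κ) :
    postDensity a m L τ w κ =
      (κ ^ ((m : ℝ) / 2) * Real.exp (-(κ * w) / 2)) * hfun a L τ κ := by
  unfold postDensity hfun
  have : a + (m : ℝ) / 2 - 1 = (m : ℝ) / 2 + (a - 1) := by ring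
  rw [this, Real.rpow_add h0]; ring

lemma hfun_nonneg (a : ℝ) (L : ℝ → ℝ) (hLpos : ∀ x > 0, 0 < L x) (τ κ : ℝ) (hτ : 0 < τ)
    (h0 : 0 < κ) (h1 : κ < 1) : 0 ≤ hfun a L τ κ := by
  have h2 : 0 < 1 - κ := by linarith
  have h3 := (one_lt_inv₀ h0).2 h1
  have h4 := hLpos ((κ⁻¹ - 1) / τ ^ 2) (div_pos (by linarith) (by positivity))
  unfold hfun; positivity

lemma post_nonneg (a : ℝ) (m : ℕ) (L : ℝ → ℝ) (hLpos : ∀ x > 0, 0 < L x) (τ w κ : ℝ) (hτ : 0 < τ)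
    (h0 : 0 < κ) (h1 : κ < 1) : 0 ≤ postDensity a m L τ w κ := by
  rw [post_eq _ _ _ _ _ _ h0]
  have := hfun_nonneg a L hLpos τ κ hτ h0 h1
  positivity

lemma post_integrable (a : ℝ) (m : ℕ) (L : ℝ → ℝ) (τ w : ℝ) (hw : 0 ≤ w) (hτ : 0 < τ)
    (hLint : IntegrableOn (fun t : ℝ => t ^ (-a - 1) * L t) (Set.Ioi 0)) :
    IntegrableOn (postDensity a m L τ w) (Set.Ioo 0 1) := by
  have h := (hfun_int a L τ hτ hLint).1
  have h2 : IntegrableOn (fun κ => (κ ^ ((m : ℝ) / 2) * Real.exp (-(κ * w) / 2)) * hfun a L τ κ)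
      (Set.Ioo 0 1) := by
    refine Integrable.bdd_mul (c := 1) h ?_ ?_
    · exact (by fun_prop : Measurable fun κ : ℝ =>
        (κ ^ ((m : ℝ) / 2) * Real.exp (-(κ * w) / 2))).aestronglyMeasurable
    · filter_upwards [ae_restrict_mem measurableSet_Ioo] with κ hκ
      rw [Real.norm_of_nonneg (by have := hκ.1; positivity)]
      refine mul_le_one₀ (Real.rpow_le_one hκ.1.le hκ.2.le (by positivity)) (by positivity) ?_
      rw [Real.exp_le_one_iff]
      have := mul_nonneg hκ.1.le hw
      linarith
  exact h2.congr_fun (fun κ hκ => (post_eq a m L τ w κ hκ.1).symm) measurableSet_Ioo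

lemma num_point (a : ℝ) (ha : 1 / 2 ≤ a) (m : ℕ) (L : ℝ → ℝ) (hLpos : ∀ x > 0, 0 < L x)
    (M : ℝ) (hLup : ∀ t > 0, L t ≤ M) (τ w κ : ℝ) (hw : 0 ≤ w) (hτ : 0 < τ)
    (h0 : 0 < κ) (h1 : κ < 1) :
    κ ^ 2 * postDensity a m L τ w κ ≤ Real.exp (-w / 4) * hfun a L τ κ +
      2 ^ (a + 1) * M * (κ ^ (a + (m : ℝ) / 2 + 2 - 1) * Real.exp (-(w / 2 * κ))) := by
  have hh := hfun_nonneg a L hLpos τ κ hτ h0 h1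
  have h3 := (one_lt_inv₀ h0).2 h1
  have hpos : 0 < (κ⁻¹ - 1) / τ ^ 2 := div_pos (by linarith) (by positivity)
  have hL := hLpos _ hpos
  have hLM := hLup _ hpos
  have hM : 0 < M := by linarith
  rcases le_total κ (1 / 2) with h | h
  · have : 0 ≤ Real.exp (-w / 4) * hfun a L τ κ := by positivity
    refine le_trans ?_ (le_add_of_nonneg_left this)
    have e : κ ^ (a + (m : ℝ) / 2 + 2 - 1) = κ ^ 2 * κ ^ (a + (m : ℝ) / 2 - 1) := by
      rw [← Real.rpow_natCast, ← Real.rpow_add h0]; congr 1; push_cast; ring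
    have e2 : Real.exp (-(w / 2 * κ)) = Real.exp (-(κ * w) / 2) := by congr 1; ring
    have e3 : (1 - κ) ^ (-a - 1) ≤ 2 ^ (a + 1) := by
      have : (2 : ℝ) ^ (a + 1) = (1 / 2) ^ (-a - 1) := by
        rw [one_div, Real.inv_rpow (by norm_num), ← Real.rpow_neg (by norm_num)]
        congr 1; ring
      rw [this]
      exact Real.rpow_le_rpow_of_nonpos (by norm_num) (by linarith) (by linarith)
    have h2 : 0 < 1 - κ := by linarith
    rw [e, e2]
    unfold postDensity
    calc _ = ((1 - κ) ^ (-a - 1) * L ((κ⁻¹ - 1) / τ ^ 2)) *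
          (κ ^ 2 * κ ^ (a + (m : ℝ) / 2 - 1) * Real.exp (-(κ * w) / 2)) := by ring
      _ ≤ _ := by gcongr
  · have : 0 ≤ 2 ^ (a + 1) * M * (κ ^ (a + (m : ℝ) / 2 + 2 - 1) * Real.exp (-(w / 2 * κ))) := by
      positivity
    refine le_trans ?_ (le_add_of_nonneg_right this)
    rw [post_eq _ _ _ _ _ _ h0, ← mul_assoc, ← mul_assoc]
    gcongr
    have a1 : κ ^ 2 * κ ^ ((m : ℝ) / 2) ≤ 1 :=
      mul_le_one₀ (pow_le_one₀ h0.le h1.le) (by positivity)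
        (Real.rpow_le_one h0.le h1.le (by positivity))
    have a2 : Real.exp (-(κ * w) / 2) ≤ Real.exp (-w / 4) := by
      rw [Real.exp_le_exp]; nlinarith
    calc _ ≤ 1 * Real.exp (-w / 4) := by gcongr
      _ = _ := one_mul _

lemma num_bound (a : ℝ) (ha : 1 / 2 ≤ a) (m : ℕ) (L : ℝ → ℝ) (hLpos : ∀ x > 0, 0 < L x)
    (M : ℝ) (hLup : ∀ t > 0, L t ≤ M) (τ w : ℝ) (hw : 0 < w) (hτ : 0 < τ)
    (hLint : IntegrableOn (fun t : ℝ => t ^ (-a - 1) * L t) (Set.Ioi 0)) :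
    ∫ κ in (0 : ℝ)..1, κ ^ 2 * postDensity a m L τ w κ ≤
      Real.exp (-w / 4) * ((τ ^ 2) ^ (-a) * ∫ t in Set.Ioi (0 : ℝ), t ^ (-a - 1) * L t) +
      2 ^ (a + 1) * M * ((1 / (w / 2)) ^ (a + (m : ℝ) / 2 + 2) * Real.Gamma (a + (m : ℝ) / 2 + 2)) := by
  have hM : 0 < M := lt_of_lt_of_le (hLpos 1 one_pos) (hLup 1 one_pos)
  have hp : 0 < a + (m : ℝ) / 2 + 2 := by positivity
  have hG := Real.integral_rpow_mul_exp_neg_mul_Ioi hp (by positivity : 0 < w / 2)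
  have hGi : IntegrableOn (fun t : ℝ => t ^ (a + (m : ℝ) / 2 + 2 - 1) * Real.exp (-(w / 2 * t)))
      (Set.Ioi 0) := by
    by_contra hc
    rw [integral_undef hc] at hG
    have : 0 < (1 / (w / 2)) ^ (a + (m : ℝ) / 2 + 2) * Real.Gamma (a + (m : ℝ) / 2 + 2) :=
      mul_pos (by positivity) (Real.Gamma_pos_of_pos hp)
    linarith
  obtain ⟨h1, h2⟩ := hfun_int a L τ hτ hLint
  have hGi' := hGi.mono_set (Set.Ioo_subset_Ioi_self : Set.Ioo (0 : ℝ) 1 ⊆ Set.Ioi 0)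
  rw [intervalIntegral.integral_of_le zero_le_one, integral_Ioc_eq_integral_Ioo, ← h2, ← hG]
  calc _ ≤ ∫ κ in Set.Ioo (0:ℝ) 1, (Real.exp (-w / 4) * hfun a L τ κ +
      2 ^ (a + 1) * M * (κ ^ (a + (m : ℝ) / 2 + 2 - 1) * Real.exp (-(w / 2 * κ)))) := by
        refine integral_mono_of_nonneg ?_ ((h1.const_mul _).add (hGi'.const_mul _)) ?_
        · filter_upwards [ae_restrict_mem measurableSet_Ioo] with κ hκ
          have := post_nonneg a m L hLpos τ w κ hτ hκ.1 hκ.2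
          simp only [Pi.zero_apply]
          positivity
        · filter_upwards [ae_restrict_mem measurableSet_Ioo] with κ hκ
          exact num_point a ha m L hLpos M hLup τ w κ hw.le hτ hκ.1 hκ.2
    _ = _ := by
        rw [integral_add (h1.const_mul _) (hGi'.const_mul _), integral_const_mul,
          integral_const_mul]
    _ ≤ _ := by
        refine add_le_add le_rfl (mul_le_mul_of_nonneg_left ?_ (by positivity))
        refine setIntegral_mono_set hGi ?_ Set.Ioo_subset_Ioi_self.eventuallyLE
        filter_upwards [ae_restrict_mem measurableSet_Ioi] with κ hκ
        have : 0 < κ := hκ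
        simp only [Pi.zero_apply]
        positivity

lemma den_bound (a : ℝ) (ha : 1 / 2 ≤ a) (m : ℕ) (hm : 1 ≤ m) (L : ℝ → ℝ)
    (hLpos : ∀ x > 0, 0 < L x)
    (c₀ t₀ : ℝ) (hc₀ : 0 < c₀) (hLlow : ∀ t ≥ t₀, c₀ ≤ L t)
    (τ w : ℝ) (hw : 2 ≤ w) (hτ : 0 < τ) (hτt : t₀ ≤ 1 / τ ^ 2)
    (hLint : IntegrableOn (fun t : ℝ => t ^ (-a - 1) * L t) (Set.Ioi 0)) :
    c₀ * Real.exp (-1 / 2) * (w ^ (-(a + (m : ℝ) / 2)) / (a + (m : ℝ) / 2)) ≤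
      ∫ κ in (0 : ℝ)..1, postDensity a m L τ w κ := by
  have hm' : (1 : ℝ) ≤ m := by exact_mod_cast hm
  have hw0 : 0 < w := by linarith
  have hwi : w⁻¹ ≤ 1 / 2 := by rw [one_div]; exact inv_anti₀ (by norm_num) hw
  have hwp : 0 < w⁻¹ := by positivity
  have hI := post_integrable a m L τ w hw0.le hτ hLint
  rw [intervalIntegral.integral_of_le zero_le_one, integral_Ioc_eq_integral_Ioo]
  have hsub : Set.Ioc 0 w⁻¹ ⊆ Set.Ioo (0:ℝ) 1 := fun x hx => ⟨hx.1, by linarith [hx.2]⟩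
  calc _ = ∫ κ in Set.Ioc (0:ℝ) w⁻¹, c₀ * Real.exp (-1 / 2) * κ ^ (a + (m : ℝ) / 2 - 1) := by
        rw [integral_const_mul, ← intervalIntegral.integral_of_le hwp.le,
          integral_rpow (Or.inl (by linarith))]
        rw [sub_add_cancel, Real.zero_rpow (by positivity), Real.inv_rpow hw0.le,
          Real.rpow_neg hw0.le, sub_zero]
    _ ≤ ∫ κ in Set.Ioc (0:ℝ) w⁻¹, postDensity a m L τ w κ := by
        refine setIntegral_mono_on ?_ (hI.mono_set hsub) measurableSet_Ioc ?_
        · refine Integrable.const_mul ?_ _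
          rw [← IntegrableOn, ← intervalIntegrable_iff_integrableOn_Ioc_of_le hwp.le]
          exact intervalIntegral.intervalIntegrable_rpow' (by linarith)
        · intro κ hκ
          have k0 : 0 < κ := hκ.1
          have k1 : κ ≤ w⁻¹ := hκ.2
          have k2 : 0 < 1 - κ := by linarith
          have b1 : 1 ≤ (1 - κ) ^ (-a - 1) :=
            Real.one_le_rpow_of_pos_of_le_one_of_nonpos k2 (by linarith) (by linarith)
          have b2 : c₀ ≤ L ((κ⁻¹ - 1) / τ ^ 2) := by
            apply hLlow
            refine hτt.trans ?_
            gcongr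
            have : (2:ℝ) ≤ κ⁻¹ := by
              rw [le_inv_comm₀ (by norm_num) k0]; linarith
            linarith
          have b3 : Real.exp (-1 / 2) ≤ Real.exp (-(κ * w) / 2) := by
            rw [Real.exp_le_exp]
            have : κ * w ≤ 1 := by
              calc κ * w ≤ w⁻¹ * w := by gcongr
                _ = 1 := inv_mul_cancel₀ hw0.ne'
            linarith
          have b4 : 0 ≤ L ((κ⁻¹ - 1) / τ ^ 2) := hc₀.le.trans b2
          unfold postDensity
          calc _ = κ ^ (a + (m : ℝ) / 2 - 1) * 1 * c₀ * Real.exp (-1 / 2) := by ring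
            _ ≤ _ := by gcongr
    _ ≤ _ := by
        refine setIntegral_mono_set hI ?_ hsub.eventuallyLE
        filter_upwards [ae_restrict_mem measurableSet_Ioo] with κ hκ
        exact post_nonneg a m L hLpos τ w κ hτ hκ.1 hκ.2

lemma det_bound (a : ℝ) (ha : 1 / 2 ≤ a) (m : ℕ) (hm : 1 ≤ m) (L : ℝ → ℝ)
    (hLpos : ∀ x > 0, 0 < L x)
    (c₀ t₀ : ℝ) (hc₀ : 0 < c₀) (hLlow : ∀ t ≥ t₀, c₀ ≤ L t)
    (M : ℝ) (hLup : ∀ t > 0, L t ≤ M) (K₀ : ℝ) (hK₀ : 0 < K₀)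
    (hLint : IntegrableOn (fun t : ℝ => t ^ (-a - 1) * L t) (Set.Ioi 0)) :
    ∃ C : ℝ, 0 ≤ C ∧ ∀ᶠ w : ℝ in atTop, ∀ (n : ℕ) (τ : ℝ), 1 ≤ n → 0 < τ → t₀ ≤ 1 / τ ^ 2 →
      1 / (n : ℝ) ^ 4 ≤ τ → K₀ * n / 4 ≤ w → w * shrinkWeightSq a m L τ w ≤ C / w := by
  obtain ⟨p, hp⟩ : ∃ p, p = a + (m : ℝ) / 2 := ⟨_, rfl⟩
  obtain ⟨J, hJ⟩ : ∃ J, J = ∫ t in Set.Ioi (0 : ℝ), t ^ (-a - 1) * L t := ⟨_, rfl⟩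
  have hM : 0 < M := lt_of_lt_of_le (hLpos 1 one_pos) (hLup 1 one_pos)
  have hp0 : 0 < p := by rw [hp]; positivity
  have hG : 0 < Real.Gamma (p + 2) := Real.Gamma_pos_of_pos (by positivity)
  have hJ0 : 0 ≤ J := by
    rw [hJ]
    refine setIntegral_nonneg measurableSet_Ioi fun t ht => ?_
    have h1 : 0 < t := ht
    have := hLpos t h1
    positivity
  obtain ⟨B, hB⟩ : ∃ B, B = ((4 / K₀) ^ 8) ^ a := ⟨_, rfl⟩
  have hB0 : 0 ≤ B := by rw [hB]; positivity
  obtain ⟨E, hE⟩ : ∃ E, E = 2 ^ (a + 1) * M * (2 ^ (p + 2) * Real.Gamma (p + 2)) := ⟨_, rfl⟩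
  have hE0 : 0 ≤ E := by rw [hE]; positivity
  obtain ⟨d, hd⟩ : ∃ d, d = c₀ * Real.exp (-1 / 2) / p := ⟨_, rfl⟩
  have hd0 : 0 < d := by rw [hd]; positivity
  refine ⟨(B * J + E) / d, by positivity, ?_⟩
  have ht := tendsto_rpow_mul_exp_neg_mul_atTop_nhds_zero (p + 2 + 8 * a) (1 / 4) (by norm_num)
  filter_upwards [ht.eventually_le_const (one_pos), eventually_ge_atTop 2] with w hw1 hw n τ hn hτ
    hτt hτn hKw
  have hw0 : 0 < w := by linarith
  have hn0 : (0 : ℝ) < n := by exact_mod_cast hn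
  have hnum := num_bound a ha m L hLpos M hLup τ w hw0 hτ hLint
  have hden := den_bound a ha m hm L hLpos c₀ t₀ hc₀ hLlow τ w hw hτ hτt hLint
  rw [← hp, ← hJ] at hnum
  rw [← hp] at hden
  have hτa : (τ ^ 2) ^ (-a) ≤ B * w ^ (8 * a) := by
    have h1 : τ⁻¹ ≤ (n : ℝ) ^ 4 := by
      rw [inv_le_comm₀ hτ (by positivity), ← one_div]; exact hτn
    have h2 : (n : ℝ) ≤ 4 / K₀ * w := by
      rw [div_mul_eq_mul_div, le_div_iff₀ hK₀]; linarith
    calc (τ ^ 2) ^ (-a) = ((τ⁻¹) ^ 2) ^ a := by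
          rw [Real.rpow_neg (by positivity), ← Real.inv_rpow (by positivity), inv_pow]
      _ ≤ (((4 / K₀ * w) ^ 4) ^ 2) ^ a := by
          have h3 : τ⁻¹ ≤ (4 / K₀ * w) ^ 4 := h1.trans (by gcongr)
          gcongr
      _ = B * w ^ (8 * a) := by
          rw [hB, ← pow_mul, mul_pow, Real.mul_rpow (by positivity) (by positivity),
            Real.rpow_mul hw0.le]
          norm_num
  have hexp : Real.exp (-w / 4) * w ^ (8 * a) ≤ w ^ (-(p + 2)) := by
    rw [Real.rpow_neg hw0.le, ← one_div, le_div_iff₀ (by positivity)]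
    refine le_trans (le_of_eq ?_) hw1
    rw [Real.rpow_add hw0 (p + 2)]
    have : -(1 / 4) * w = -w / 4 := by ring
    rw [this]; ring
  have hnum2 : ∫ κ in (0 : ℝ)..1, κ ^ 2 * postDensity a m L τ w κ ≤
      (B * J + E) * w ^ (-(p + 2)) := by
    refine hnum.trans ?_
    have e1 : (1 / (w / 2)) ^ (p + 2) = 2 ^ (p + 2) * w ^ (-(p + 2)) := by
      rw [one_div_div, Real.div_rpow (by norm_num) hw0.le, Real.rpow_neg hw0.le]; rfl
    rw [e1]
    calc _ ≤ Real.exp (-w / 4) * (B * w ^ (8 * a) * J) +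
          2 ^ (a + 1) * M * (2 ^ (p + 2) * w ^ (-(p + 2)) * Real.Gamma (p + 2)) := by gcongr
      _ = B * J * (Real.exp (-w / 4) * w ^ (8 * a)) + E * w ^ (-(p + 2)) := by rw [hE]; ring
      _ ≤ B * J * w ^ (-(p + 2)) + E * w ^ (-(p + 2)) := by gcongr
      _ = _ := by ring
  have hden2 : d * w ^ (-p) ≤ ∫ κ in (0 : ℝ)..1, postDensity a m L τ w κ := by
    refine le_trans (le_of_eq ?_) hden
    rw [hd]; ring
  have hq : shrinkWeightSq a m L τ w ≤ ((B * J + E) * w ^ (-(p + 2))) / (d * w ^ (-p)) := by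
    unfold shrinkWeightSq
    gcongr
  have e3 : w ^ (-(p + 2)) = w ^ (-p) / w ^ 2 := by
    rw [neg_add, ← sub_eq_add_neg, Real.rpow_sub hw0]; norm_num
  have hwp : 0 < w ^ (-p) := by positivity
  calc _ ≤ w * (((B * J + E) * w ^ (-(p + 2))) / (d * w ^ (-p))) := by gcongr
    _ = _ := by rw [e3]; field_simp

lemma tau_low (τ : ℕ → ℝ) (hτpos : ∀ n, 0 < τ n)
    (G : ℕ → ℕ) (hGn : ∀ n, G n ≤ n) (hτ0 : Tendsto τ atTop (nhds 0))
    (hτG : Tendsto (fun n => (G n : ℝ) * Real.sqrt (τ n) * Real.log (1 / τ n)) atTop atTop) :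
    ∀ᶠ n : ℕ in atTop, 1 / (n : ℝ) ^ 4 ≤ τ n := by
  filter_upwards [hτG.eventually_ge_atTop 4, eventually_ge_atTop 1,
    hτ0.eventually_le_const one_pos] with n h hn h1
  have hn0 : (0 : ℝ) < n := by exact_mod_cast hn
  have hτ := hτpos n
  obtain ⟨r, hr⟩ : ∃ r, r = (τ n) ^ (1 / 4 : ℝ) := ⟨_, rfl⟩
  have hr0 : 0 < r := by rw [hr]; positivity
  have hr4 : r ^ 4 = τ n := by
    rw [hr, ← Real.rpow_natCast, ← Real.rpow_mul hτ.le]; norm_num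
  have hs : Real.sqrt (τ n) = r ^ 2 := by
    rw [Real.sqrt_eq_iff_mul_self_eq hτ.le (by positivity), ← hr4]; ring
  have hlog : Real.log (1 / τ n) ≤ 4 * r⁻¹ := by
    have := Real.log_le_rpow_div (x := 1 / τ n) (by positivity) (ε := 1 / 4) (by norm_num)
    rw [one_div (τ n), Real.inv_rpow hτ.le, ← hr] at this
    rw [one_div]; linarith
  have hG : (G n : ℝ) ≤ n := by exact_mod_cast hGn n
  have : 4 ≤ 4 * (n * r) := by
    calc (4 : ℝ) ≤ (G n : ℝ) * Real.sqrt (τ n) * Real.log (1 / τ n) := h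
      _ ≤ (G n : ℝ) * r ^ 2 * (4 * r⁻¹) := by rw [hs]; gcongr
      _ = 4 * (G n * r) := by field_simp
      _ ≤ _ := by gcongr
  have h2 : 1 ≤ n * r := by linarith
  rw [div_le_iff₀ (by positivity), ← hr4, ← mul_pow, mul_comm]
  exact one_le_pow₀ h2

lemma card_div (τ : ℕ → ℝ) (G : ℕ → ℕ) (hGn : ∀ n, G n ≤ n) (A : ℕ → Finset ℕ)
    (hτG : Tendsto (fun n => (G n : ℝ) * Real.sqrt (τ n) * Real.log (1 / τ n)) atTop atTop)
    (hτA : Tendsto (fun n => ((A n).card : ℝ) * Real.sqrt (τ n) * Real.log (1 / τ n))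
      atTop (nhds 0)) : Tendsto (fun n => ((A n).card : ℝ) / n) atTop (nhds 0) := by
  refine squeeze_zero' (Eventually.of_forall fun n => by positivity) ?_ hτA
  filter_upwards [hτG.eventually_ge_atTop 1, eventually_ge_atTop 1] with n h hn
  have hn0 : (0 : ℝ) < n := by exact_mod_cast hn
  have hG : (G n : ℝ) ≤ n := by exact_mod_cast hGn n
  rw [div_le_iff₀ hn0]
  rw [mul_assoc] at h ⊢
  have hq : 0 < Real.sqrt (τ n) * Real.log (1 / τ n) := by
    by_contra hc
    push Not at hc
    have : (G n : ℝ) * (Real.sqrt (τ n) * Real.log (1 / τ n)) ≤ 0 :=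
      mul_nonpos_of_nonneg_of_nonpos (by positivity) hc
    linarith
  have : 1 ≤ n * (Real.sqrt (τ n) * Real.log (1 / τ n)) := h.trans (by gcongr)
  calc ((A n).card : ℝ) = (A n).card * 1 := by ring
    _ ≤ (A n).card * (n * (Real.sqrt (τ n) * Real.log (1 / τ n))) := by gcongr
    _ = _ := by ring

lemma gauss_tail {Ω : Type*} [MeasureSpace Ω] [IsProbabilityMeasure (ℙ : Measure Ω)]
    (m : ℕ) (Z : ℕ → Ω → ℝ) (hZ : ∀ j, Measurable (Z j))
    (hlaw : Measure.map (fun ω (j : Fin m) => Z (j : ℕ) ω) ℙ =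
        Measure.pi fun _ : Fin m => gaussianReal 0 1) (x : ℝ) (hx : 0 < x) :
    ℙ {ω | x ≤ ∑ j ∈ Finset.range m, Z j ω ^ 2} ≤ ENNReal.ofReal (m / x) := by
  have hmap : ∀ j ∈ Finset.range m, Measure.map (Z j) ℙ = gaussianReal 0 1 := by
    intro j hj
    have hj' := Finset.mem_range.1 hj
    have h1 : Measure.map (Function.eval (⟨j, hj'⟩ : Fin m))
        (Measure.map (fun ω (j : Fin m) => Z (j : ℕ) ω) ℙ) = Measure.map (Z j) ℙ := by
      have hmeas : Measurable (fun ω (j : Fin m) => Z (j : ℕ) ω) :=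
        measurable_pi_lambda _ fun i => hZ i
      have hev : Measurable (Function.eval (⟨j, hj'⟩ : Fin m) : (Fin m → ℝ) → ℝ) :=
        measurable_pi_apply _
      rw [Measure.map_map hev hmeas]
      rfl
    rw [← h1, hlaw]
    exact (measurePreserving_eval (fun _ : Fin m => gaussianReal 0 1) ⟨j, hj'⟩).map_eq
  have hInt : ∀ j ∈ Finset.range m, Integrable (fun ω => Z j ω ^ 2) ℙ := by
    intro j hj
    have h1 : Integrable (fun y : ℝ => y ^ 2) (Measure.map (Z j) ℙ) := by
      rw [hmap j hj]
      exact (memLp_id_gaussianReal 2).integrable_sq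
    exact h1.comp_measurable (hZ j)
  have hval : ∀ j ∈ Finset.range m, ∫ ω, Z j ω ^ 2 ∂ℙ = 1 := by
    intro j hj
    have h1 : ∫ y, y ^ 2 ∂(Measure.map (Z j) ℙ) = ∫ ω, Z j ω ^ 2 ∂ℙ :=
      integral_map (hZ j).aemeasurable (by fun_prop)
    rw [← h1, hmap j hj]
    have h2 := variance_id_gaussianReal (μ := 0) (v := 1)
    rw [variance_of_integral_eq_zero (by fun_prop) (by simp)] at h2
    simpa using h2
  have hmk := mul_meas_ge_le_integral_of_nonneg (μ := (ℙ : Measure Ω))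
    (f := fun ω => ∑ j ∈ Finset.range m, Z j ω ^ 2)
    (Eventually.of_forall fun ω => Finset.sum_nonneg fun j _ => sq_nonneg _)
    (integrable_finsetSum _ hInt) x
  rw [integral_finsetSum _ hInt, Finset.sum_congr rfl hval] at hmk
  simp only [Finset.sum_const, Finset.card_range, nsmul_eq_mul, mul_one] at hmk
  rw [← ofReal_measureReal]
  refine ENNReal.ofReal_le_ofReal ?_
  rw [le_div_iff₀ hx, mul_comm]
  exact hmk
/-- **Key step (5.42) in the proof of Theorem 2.** In the shrinkage prior setup with `a ≥ 1/2`,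
`L` satisfying Assumption 1 and group sizes bounded by `s`, if for each active group
`W_{n,g} = Σ_j (Z_{n,g,j} + θ_{n,g,j})²` with i.i.d. standard normal `Z` and `‖θ_{n,g}‖² ≥ K₀ n`,
and `τ_n → 0` with `G_n √τ_n log(1/τ_n) → ∞` and `|A_n| √τ_n log(1/τ_n) → 0`, then
`Σ_{g ∈ A_n} W_{n,g} · R₂_{m_{n,g}}(τ_n, W_{n,g}) → 0` in probability. -/
theorem key_step_sum_shrinkage_to_zero
    {Ω : Type*} [MeasureSpace Ω] [IsProbabilityMeasure (ℙ : Measure Ω)]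
    (a : ℝ) (ha : 1 / 2 ≤ a)
    (L : ℝ → ℝ) (hLmeas : Measurable L) (hLpos : ∀ x > 0, 0 < L x)
    (hLsv : ∀ c > 0, Tendsto (fun x => L (c * x) / L x) atTop (nhds 1))
    (c₀ t₀ : ℝ) (hc₀ : 0 < c₀) (ht₀ : 0 < t₀) (hLlow : ∀ t ≥ t₀, c₀ ≤ L t)
    (M : ℝ) (hLup : ∀ t > 0, L t ≤ M)
    (K : ℝ) (hK : 0 < K)
    (hLint : IntegrableOn (fun t : ℝ => t ^ (-a - 1) * L t) (Set.Ioi 0))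
    (hKval : ∫ t in Set.Ioi (0 : ℝ), t ^ (-a - 1) * L t = 1 / K)
    (s : ℕ) (hs : 1 ≤ s)
    (G : ℕ → ℕ) (hGn : ∀ n, G n ≤ n)
    (A : ℕ → Finset ℕ) (hAG : ∀ n, (A n).card ≤ G n)
    (m : ℕ → ℕ → ℕ) (hm : ∀ n, ∀ g ∈ A n, 1 ≤ m n g ∧ m n g ≤ s)
    (K₀ : ℝ) (hK₀ : 0 < K₀)
    (Z : ℕ → ℕ → ℕ → Ω → ℝ) (θ : ℕ → ℕ → ℕ → ℝ)
    (hZmeas : ∀ n g j, Measurable (Z n g j))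
    (hZlaw : ∀ n : ℕ, 2 ≤ n → ∀ g ∈ A n,
      Measure.map (fun ω (j : Fin (m n g)) => Z n g (j : ℕ) ω) ℙ =
        Measure.pi fun _ : Fin (m n g) => gaussianReal 0 1)
    (W : ℕ → ℕ → Ω → ℝ)
    (hWact : ∀ n : ℕ, 2 ≤ n → ∀ g ∈ A n,
      W n g = fun ω => ∑ j ∈ Finset.range (m n g), (Z n g j ω + θ n g j) ^ 2)
    (hθ : ∀ n : ℕ, 2 ≤ n → ∀ g ∈ A n,
      K₀ * (n : ℝ) ≤ ∑ j ∈ Finset.range (m n g), θ n g j ^ 2)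
    (τ : ℕ → ℝ) (hτpos : ∀ n, 0 < τ n) (hτ0 : Tendsto τ atTop (nhds 0))
    (hτG : Tendsto (fun n => (G n : ℝ) * Real.sqrt (τ n) * Real.log (1 / τ n)) atTop atTop)
    (hτA : Tendsto (fun n => ((A n).card : ℝ) * Real.sqrt (τ n) * Real.log (1 / τ n))
      atTop (nhds 0)) :
    ∀ ε > (0 : ℝ),
      Tendsto
        (fun n =>
          ℙ {ω | ε < ∑ g ∈ A n, W n g ω * shrinkWeightSq a (m n g) L (τ n) (W n g ω)})
        atTop (nhds 0) := by
  intro ε hε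
  have hcard := card_div τ G hGn A hτG hτA
  -- uniform deterministic bound
  have hdet : ∃ C : ℝ, 0 ≤ C ∧ ∀ᶠ w : ℝ in atTop, ∀ m' : ℕ, 1 ≤ m' → m' ≤ s →
      ∀ (n : ℕ) (τ : ℝ), 1 ≤ n → 0 < τ → t₀ ≤ 1 / τ ^ 2 →
      1 / (n : ℝ) ^ 4 ≤ τ → K₀ * n / 4 ≤ w → w * shrinkWeightSq a m' L τ w ≤ C / w := by
    have hex : ∀ m' : ℕ, ∃ C : ℝ, 0 ≤ C ∧ (1 ≤ m' → ∀ᶠ w : ℝ in atTop,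
        ∀ (n : ℕ) (τ : ℝ), 1 ≤ n → 0 < τ → t₀ ≤ 1 / τ ^ 2 →
        1 / (n : ℝ) ^ 4 ≤ τ → K₀ * n / 4 ≤ w → w * shrinkWeightSq a m' L τ w ≤ C / w) := by
      intro m'
      by_cases h : 1 ≤ m'
      · obtain ⟨C, h1, h2⟩ := det_bound a ha m' h L hLpos c₀ t₀ hc₀ hLlow M hLup K₀ hK₀ hLint
        exact ⟨C, h1, fun _ => h2⟩
      · exact ⟨0, le_rfl, fun h' => absurd h' h⟩
    choose C hC0 hC using hex
    refine ⟨∑ i ∈ Finset.range (s + 1), C i, Finset.sum_nonneg fun i _ => hC0 i, ?_⟩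
    have hall : ∀ᶠ w : ℝ in atTop, ∀ m' ∈ Finset.Icc 1 s,
        ∀ (n : ℕ) (τ : ℝ), 1 ≤ n → 0 < τ → t₀ ≤ 1 / τ ^ 2 →
        1 / (n : ℝ) ^ 4 ≤ τ → K₀ * n / 4 ≤ w → w * shrinkWeightSq a m' L τ w ≤ C m' / w := by
      rw [Filter.eventually_all_finset]
      intro m' hm'
      exact hC m' (Finset.mem_Icc.1 hm').1
    filter_upwards [hall, eventually_gt_atTop 0] with w hw hw0 m' h1 h2 n τ' b1 b2 b3 b4 b5
    refine (hw m' (Finset.mem_Icc.2 ⟨h1, h2⟩) n τ' b1 b2 b3 b4 b5).trans ?_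
    gcongr
    exact Finset.single_le_sum (f := C) (fun i _ => hC0 i) (Finset.mem_range.2 (by omega))
  obtain ⟨C, hC0, hC⟩ := hdet
  obtain ⟨w1, hw1⟩ := eventually_atTop.1 hC
  have hnw : ∀ᶠ n : ℕ in atTop, w1 ≤ K₀ * (n : ℝ) / 4 := by
    have : Tendsto (fun n : ℕ => K₀ * (n : ℝ) / 4) atTop atTop :=
      (tendsto_natCast_atTop_atTop.const_mul_atTop hK₀).atTop_div_const (by norm_num)
    exact this.eventually_ge_atTop w1
  have hτt : ∀ᶠ n in atTop, t₀ ≤ 1 / τ n ^ 2 := by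
    have h1 : Tendsto (fun n => t₀ * τ n ^ 2) atTop (nhds 0) := by
      simpa using (hτ0.pow 2).const_mul t₀
    filter_upwards [h1.eventually_le_const one_pos] with n hn
    rw [le_div_iff₀ (by have := hτpos n; positivity)]
    exact hn
  have hsmall : ∀ᶠ n in atTop, ((A n).card : ℝ) / n * (4 * C / K₀) ≤ ε := by
    have h1 : Tendsto (fun n => ((A n).card : ℝ) / n * (4 * C / K₀)) atTop (nhds 0) := by
      simpa using hcard.mul_const (4 * C / K₀)
    exact h1.eventually_le_const hε
  have hlim : Tendsto (fun n => ENNReal.ofReal (((A n).card : ℝ) / n * (4 * s / K₀)))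
      atTop (nhds 0) := by
    have h1 : Tendsto (fun n => ((A n).card : ℝ) / n * (4 * s / K₀)) atTop (nhds 0) := by
      simpa using hcard.mul_const (4 * s / K₀)
    simpa using ENNReal.tendsto_ofReal h1
  refine tendsto_of_tendsto_of_tendsto_of_le_of_le' tendsto_const_nhds hlim
    (Eventually.of_forall fun n => zero_le) ?_
  filter_upwards [hnw, hτt, hsmall, tau_low τ hτpos G hGn hτ0 hτG, eventually_ge_atTop 2]
    with n hnw hτt hsmall hτlow hn
  have hn0 : (0 : ℝ) < n := by
    have : 0 < n := by omega
    exact_mod_cast this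
  have hsub : {ω | ε < ∑ g ∈ A n, W n g ω * shrinkWeightSq a (m n g) L (τ n) (W n g ω)} ⊆
      ⋃ g ∈ A n, {ω | K₀ * n / 4 ≤ ∑ j ∈ Finset.range (m n g), Z n g j ω ^ 2} := by
    intro ω hω
    by_contra hc
    rw [Set.mem_ofPred_eq] at hω
    simp only [Set.mem_iUnion, Set.mem_ofPred_eq, not_exists, not_le] at hc
    refine absurd hω (not_lt.2 ?_)
    refine le_trans ?_ hsmall
    have hterm : ∀ g ∈ A n, W n g ω * shrinkWeightSq a (m n g) L (τ n) (W n g ω) ≤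
        4 * C / K₀ / n := by
      intro g hg
      have hWl : K₀ * n / 4 ≤ W n g ω := by
        have e := congrFun (hWact n hn g hg) ω
        have h1 : (∑ j ∈ Finset.range (m n g), θ n g j ^ 2) / 2 -
            ∑ j ∈ Finset.range (m n g), Z n g j ω ^ 2 ≤ W n g ω := by
          rw [e, Finset.sum_div, ← Finset.sum_sub_distrib]
          refine Finset.sum_le_sum fun j _ => ?_
          nlinarith [sq_nonneg (2 * Z n g j ω + θ n g j)]
        have h2 := hθ n hn g hg
        have h3 := hc g hg
        linarith
      obtain ⟨m1, m2⟩ := hm n g hg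
      refine (hw1 _ (hnw.trans hWl) (m n g) m1 m2 n (τ n) (by omega) (hτpos n) hτt hτlow
        hWl).trans ?_
      calc C / W n g ω ≤ C / (K₀ * n / 4) := by gcongr
        _ = _ := by field_simp
    calc _ ≤ ∑ g ∈ A n, 4 * C / K₀ / n := Finset.sum_le_sum hterm
      _ = _ := by rw [Finset.sum_const, nsmul_eq_mul]; ring
  calc _ ≤ ∑ g ∈ A n, ℙ {ω | K₀ * n / 4 ≤ ∑ j ∈ Finset.range (m n g), Z n g j ω ^ 2} :=
        (measure_mono hsub).trans (measure_biUnion_finset_le _ _)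
    _ ≤ ∑ g ∈ A n, ENNReal.ofReal (4 * s / K₀ / n) := by
        refine Finset.sum_le_sum fun g hg => ?_
        refine (gauss_tail (m n g) (Z n g) (hZmeas n g) (hZlaw n hn g hg) _
          (by positivity)).trans (ENNReal.ofReal_le_ofReal ?_)
        have : (m n g : ℝ) ≤ s := by exact_mod_cast (hm n g hg).2
        calc (m n g : ℝ) / (K₀ * n / 4) ≤ s / (K₀ * n / 4) := by gcongr
          _ = _ := by field_simp
    _ = _ := by
        rw [Finset.sum_const, nsmul_eq_mul, ← ENNReal.ofReal_natCast,
          ← ENNReal.ofReal_mul (by positivity)]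
        congr 1; ring
end
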